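/- Let α ≥ 0, p ∈ ℤ² ∖ {0}, and Γ ∈ ℂ. Define β(m,n) = (1/2)·( 1/(‖n‖²(1+α²‖n‖²)) − 1/(‖m‖²(1+α²‖m‖²)) )·(m ∧ n) for m, n ∈ ℤ² ∖ {0}, and β(m,n) = 0 if m = 0 or n = 0. Define ω⁰ : ℤ² → ℂ by ω⁰_p = Γ/2, ω⁰_{−p} = conj(Γ)/2, and ω⁰_k = 0 for k ∉ {p, −p}. Then for every k ∈ ℤ² ∖ {0}, the (finitely supported) sum ∑_{q ∈ ℤ² ∖ {0}} β(k−q, q)·ω⁰_{k−q}·ω⁰_q equals 0. (The unidirectional flow is a steady state of the α-Euler equations in Fourier form.) -/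

import Mathlib

open Filter Topology

/-- Euclidean norm of a point of the integer lattice `ℤ²`. -/
noncomputable def znorm (v : ℤ × ℤ) : ℝ := Real.sqrt ((v.1 : ℝ) ^ 2 + (v.2 : ℝ) ^ 2)

/-- The wedge product `m ∧ n = m₁n₂ − m₂n₁`. -/
def wedge (m n : ℤ × ℤ) : ℤ := m.1 * n.2 - m.2 * n.1

/-- The coefficients `β(m,n)` of the α-Euler equations in Fourier form. -/
noncomputable def betaCoef (α : ℝ) (m n : ℤ × ℤ) : ℝ :=
  if m = 0 ∨ n = 0 then 0
  else (1 / 2) * (1 / (znorm n ^ 2 * (1 + α ^ 2 * znorm n ^ 2))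
      - 1 / (znorm m ^ 2 * (1 + α ^ 2 * znorm m ^ 2))) * (wedge m n : ℝ)

/-- The Fourier coefficients of the unidirectional steady state `ω⁰`. -/
noncomputable def omega0 (p : ℤ × ℤ) (Γ : ℂ) (k : ℤ × ℤ) : ℂ :=
  if k = p then Γ / 2 else if k = -p then (starRingEnd ℂ Γ) / 2 else 0

theorem betaCoef_eq_zero_of_wedge_eq_zero (α : ℝ) {m n : ℤ × ℤ} (h : wedge m n = 0) :
    betaCoef α m n = 0 := by
  simp [betaCoef, h]

theorem eq_or_eq_neg_of_omega0_ne_zero {p : ℤ × ℤ} {Γ : ℂ} {k : ℤ × ℤ}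
    (h : omega0 p Γ k ≠ 0) : k = p ∨ k = -p := by
  contrapose! h
  simp [omega0, h.1, h.2]

theorem wedge_eq_zero_of_eq_or_eq_neg {p m n : ℤ × ℤ} (hm : m = p ∨ m = -p)
    (hn : n = p ∨ n = -p) : wedge m n = 0 := by
  rcases hm with rfl | rfl <;> rcases hn with rfl | rfl <;> simp [wedge] <;> ring

/-- The unidirectional flow is a steady state of the α-Euler equations in Fourier
form: the quadratic term vanishes at `ω⁰` for every mode `k ≠ 0`. -/
theorem unidirectional_steady_state
    (α : ℝ) (hα : 0 ≤ α) (p : ℤ × ℤ) (hp : p ≠ 0) (Γ : ℂ) :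
    ∀ k : ℤ × ℤ, k ≠ 0 →
      (∑ᶠ (q : ℤ × ℤ) (_ : q ≠ 0),
        (betaCoef α (k - q) q : ℂ) * omega0 p Γ (k - q) * omega0 p Γ q) = 0 := by
  intro k _
  have h_term : ∀ q : ℤ × ℤ,
      (betaCoef α (k - q) q : ℂ) * omega0 p Γ (k - q) * omega0 p Γ q = 0 := by
    intro q
    by_contra h
    obtain ⟨⟨hβ, hm⟩, hn⟩ : (betaCoef α (k - q) q ≠ 0 ∧ omega0 p Γ (k - q) ≠ 0) ∧
        omega0 p Γ q ≠ 0 := by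
      simpa only [mul_ne_zero_iff, Complex.ofReal_ne_zero] using h
    exact hβ (betaCoef_eq_zero_of_wedge_eq_zero α (wedge_eq_zero_of_eq_or_eq_neg
      (eq_or_eq_neg_of_omega0_ne_zero hm) (eq_or_eq_neg_of_omega0_ne_zero hn)))
  simp only [h_term, finsum_zero]
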